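/- arXiv:1810.04899 — 2 statements merged into one kernel-verified Lean document; each statement's English description precedes it below -/
import Mathlib

section
/- Let (V, ω) be a ℤ-graded conformal vertex algebra and set CV⁺ = {a ∈ CV ∩ V_{≥2} | pr_2(a) = ω}, where CV is the set of conformal vectors of V. Then the map φ : Aut⁺V → CV⁺ given by f ↦ f(ω) is a bijection. -/
/-!
Common framework: vertex algebras, ℤ-graded (conformal) vertex algebras,
conformal vectors, automorphism groups, following Moriwaki,
"On classification of conformal vectors in vertex operator algebra and
the vertex algebra automorphism group".
-/

noncomputable section

open scoped BigOperators

/-- The generalized binomial coefficient `binom(m, i)` for `m : ℤ`, valued in a field `K`. -/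
def zBinom (K : Type*) [Field K] (m : ℤ) (i : ℕ) : K :=
  (∏ j ∈ Finset.range i, ((m : K) - (j : K))) / (Nat.factorial i : K)

/-- A vertex algebra over a field `K`: a `K`-vector space `V` equipped with bilinear
`n`-th products `a(n)b` (`n : ℤ`) and a vacuum vector `𝟙`, subject to the truncation
condition, the vacuum and creation axioms, and the Borcherds identity. -/
structure VA (K V : Type*) [Field K] [AddCommGroup V] [Module K V] where
  /-- the `n`-th product `a(n)b`, bilinear in `a` and `b` -/
  ncoef : ℤ → V →ₗ[K] V →ₗ[K] V
  /-- the vacuum vector `𝟙` -/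
  vac : V
  /-- truncation: `a(n)b = 0` for `n` sufficiently large -/
  trunc : ∀ a b : V, ∃ N : ℤ, ∀ n : ℤ, N ≤ n → ncoef n a b = 0
  /-- the vacuum axiom `Y(𝟙, z) = id`, i.e. `𝟙(n)a = δ_{n,-1} a` -/
  vac_ncoef : ∀ (n : ℤ) (a : V), ncoef n vac a = if n = -1 then a else 0
  /-- creation: `a(-1)𝟙 = a` -/
  ncoef_vac : ∀ a : V, ncoef (-1) a vac = a
  /-- creation: `a(n)𝟙 = 0` for `n ≥ 0` -/
  ncoef_vac_zero : ∀ n : ℤ, 0 ≤ n → ∀ a : V, ncoef n a vac = 0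
  /-- the Borcherds identity -/
  borcherds : ∀ (a b c : V) (p q m : ℤ),
    (∑ᶠ i : ℕ, zBinom K m i •
        ncoef (m + q - (i : ℤ)) (ncoef (p + (i : ℤ)) a b) c)
      = ∑ᶠ i : ℕ, ((-1 : K) ^ i * zBinom K p i) •
          (ncoef (m + p - (i : ℤ)) a (ncoef (q + (i : ℤ)) b c)
            - ((p.negOnePow : ℤ) : K) •
                ncoef (p + q - (i : ℤ)) b (ncoef (m + (i : ℤ)) a c))

namespace VA

variable {K V : Type*} [Field K] [AddCommGroup V] [Module K V]

/-- The translation operator `T a = a(-2)𝟙`. -/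
def T (A : VA K V) : V →ₗ[K] V := (A.ncoef (-2)).flip A.vac

/-- The eigenspace `V_n^a = {v ∈ V | a(1)v = n v}` of `a(1)`. -/
def eig (A : VA K V) (a : V) (n : ℤ) : Submodule K V :=
  LinearMap.ker (A.ncoef 1 a - (n : K) • (LinearMap.id : V →ₗ[K] V))

/-- `a` is a conformal vector: `a(1)a = 2a`, `a(3)a ∈ K𝟙`, `a(2)a = 0`, `a(n)a = 0`
for `n ≥ 4`, `a(0) = T`, and `a(1)` is semisimple with integer eigenvalues
(`V = ⊕_{n ∈ ℤ} V_n^a`). -/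
def IsConformal (A : VA K V) (a : V) : Prop :=
  A.ncoef 1 a a = (2 : K) • a ∧
  (∃ c : K, A.ncoef 3 a a = c • A.vac) ∧
  A.ncoef 2 a a = 0 ∧
  (∀ n : ℤ, 4 ≤ n → A.ncoef n a a = 0) ∧
  A.ncoef 0 a = A.T ∧
  DirectSum.IsInternal (A.eig a)

/-- `a` is a conformal vector of CFT type: `(V, a)` is a VOA of CFT type, i.e.
`V = ⊕_{n ∈ ℕ} V_n^a` with finite-dimensional pieces and `V_0^a = K𝟙`. -/
def IsConformalCFT (A : VA K V) (a : V) : Prop :=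
  A.IsConformal a ∧
  (∀ n : ℤ, n < 0 → A.eig a n = ⊥) ∧
  (∀ n : ℤ, FiniteDimensional K (A.eig a n)) ∧
  A.eig a 0 = Submodule.span K {A.vac}

/-- `a` is a conformal vector of strong CFT type: of CFT type and `a(2)V_1^a = 0`
(i.e. `L^a(1) V_1^a = 0`). -/
def IsConformalSCFT (A : VA K V) (a : V) : Prop :=
  A.IsConformalCFT a ∧ ∀ v ∈ A.eig a 1, A.ncoef 2 a v = 0

/-- A vertex algebra homomorphism: a linear map preserving all products and the vacuum. -/
structure IsVAHom (A : VA K V) (f : V → V) : Prop where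
  map_add : ∀ a b : V, f (a + b) = f a + f b
  map_smul : ∀ (c : K) (a : V), f (c • a) = c • f a
  map_ncoef : ∀ (n : ℤ) (a b : V), f (A.ncoef n a b) = A.ncoef n (f a) (f b)
  map_vac : f A.vac = A.vac

/-- A vertex algebra automorphism: a bijective vertex algebra homomorphism. -/
def IsVAAut (A : VA K V) (f : V → V) : Prop :=
  A.IsVAHom f ∧ Function.Bijective f

/-- A (two-sided) ideal of a vertex algebra. -/
def IsIdeal (A : VA K V) (I : Submodule K V) : Prop :=
  ∀ (n : ℤ) (a : V), ∀ b ∈ I, A.ncoef n a b ∈ I ∧ A.ncoef n b a ∈ I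

/-- A vertex algebra is simple if it has no ideals other than `0` and itself. -/
def IsSimple (A : VA K V) : Prop :=
  ∀ I : Submodule K V, A.IsIdeal I → I = ⊥ ∨ I = ⊤

end VA

/-- The exponential `exp f = Σ_{n≥0} f^n / n!` of an endomorphism, as a function
(meaningful for locally nilpotent `f`). -/
def expOp {K V : Type*} [Field K] [AddCommGroup V] [Module K V]
    (f : V →ₗ[K] V) (v : V) : V :=
  ∑ᶠ n : ℕ, (Nat.factorial n : K)⁻¹ • (f ^ n) v

/-- A ℤ-grading on a vertex algebra, making it a ℤ-graded vertex algebra: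
`V = ⊕_{n ∈ ℤ} V_n`, `V_n(k)V_m ⊆ V_{n+m-k-1}` and `𝟙 ∈ V_0`. -/
structure GradedVA {K V : Type*} [Field K] [AddCommGroup V] [Module K V] (A : VA K V) where
  /-- the grading subspaces `V_n` -/
  gr : ℤ → Submodule K V
  /-- `V = ⊕_{n ∈ ℤ} V_n` -/
  decomp : DirectSum.Decomposition gr
  /-- `𝟙 ∈ V_0` -/
  vac_mem : A.vac ∈ gr 0
  /-- `V_n(k)V_m ⊆ V_{n+m-k-1}` -/
  ncoef_mem : ∀ (n m k : ℤ), ∀ a ∈ gr n, ∀ b ∈ gr m, A.ncoef k a b ∈ gr (n + m - k - 1)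

namespace GradedVA

variable {K V : Type*} [Field K] [AddCommGroup V] [Module K V] {A : VA K V}

/-- The canonical projection `pr_n : V → V_n`. -/
def pr (G : GradedVA A) (n : ℤ) (v : V) : V :=
  letI := G.decomp
  (DirectSum.decompose G.gr v n : V)

/-- `V_{≥n} = ⊕_{i ≥ n} V_i`. -/
def ge (G : GradedVA A) (n : ℤ) : Submodule K V := ⨆ i ≥ n, G.gr i

/-- `V_{≤n} = ⊕_{i ≤ n} V_i`. -/
def le (G : GradedVA A) (n : ℤ) : Submodule K V := ⨆ i ≤ n, G.gr i

/-- `J_1(V) = {a ∈ V_1 | a(0) = 0}`. -/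
def J1 (G : GradedVA A) : Set V :=
  {a : V | a ∈ G.gr 1 ∧ A.ncoef 0 a = 0}

/-- `Aut⁺V`: automorphisms `f` with `f(V_n) ⊆ V_{≥n}` and `pr_n ∘ f|_{V_n} = id`. -/
def AutPlus (G : GradedVA A) (f : V → V) : Prop :=
  A.IsVAAut f ∧ ∀ n : ℤ, ∀ v ∈ G.gr n, f v ∈ G.ge n ∧ G.pr n (f v) = v

/-- `Aut⁻V`: automorphisms `f` with `f(V_n) ⊆ ⊕_{k ≤ n} V_k` and `pr_n ∘ f|_{V_n} = id`. -/
def AutMinus (G : GradedVA A) (f : V → V) : Prop :=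
  A.IsVAAut f ∧ ∀ n : ℤ, ∀ v ∈ G.gr n, f v ∈ G.le n ∧ G.pr n (f v) = v

/-- `Aut⁰V`: automorphisms `f` with `f(V_n) ⊆ V_n`. -/
def AutZero (G : GradedVA A) (f : V → V) : Prop :=
  A.IsVAAut f ∧ ∀ n : ℤ, ∀ v ∈ G.gr n, f v ∈ G.gr n

end GradedVA

/-- A ℤ-graded conformal vertex algebra: a ℤ-graded vertex algebra with a conformal
vector `ω ∈ V_2` whose modes `L(n) = ω(n+1)` satisfy the Virasoro relations, with
`L(0)v = n v` for `v ∈ V_n` and `L(-1) = T`. -/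
structure ConfGVA {K V : Type*} [Field K] [AddCommGroup V] [Module K V] (A : VA K V)
    extends GradedVA A where
  /-- the conformal vector -/
  ω : V
  ω_mem : ω ∈ gr 2
  /-- the Virasoro relations `[L(n), L(m)] = (n-m)L(n+m) + δ_{n+m,0}((n³-n)/12)c` -/
  virasoro : ∃ c : K, ∀ n m : ℤ,
    A.ncoef (n + 1) ω ∘ₗ A.ncoef (m + 1) ω - A.ncoef (m + 1) ω ∘ₗ A.ncoef (n + 1) ω
      = ((n : K) - (m : K)) • A.ncoef (n + m + 1) ω
        + (if n + m = 0 then ((n : K) ^ 3 - (n : K)) / 12 * c else 0)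
            • (LinearMap.id : V →ₗ[K] V)
  /-- `L(0) v = n v` for `v ∈ V_n` -/
  L0_grading : ∀ n : ℤ, ∀ v ∈ gr n, A.ncoef 1 ω v = (n : K) • v
  /-- `L(-1) = T` -/
  Lneg1_eq_T : A.ncoef 0 ω = A.T

namespace ConfGVA

variable {K V : Type*} [Field K] [AddCommGroup V] [Module K V] {A : VA K V}

abbrev pr (C : ConfGVA A) : ℤ → V → V := C.toGradedVA.pr
abbrev ge (C : ConfGVA A) : ℤ → Submodule K V := C.toGradedVA.ge
abbrev le (C : ConfGVA A) : ℤ → Submodule K V := C.toGradedVA.le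
abbrev J1 (C : ConfGVA A) : Set V := C.toGradedVA.J1
abbrev AutPlus (C : ConfGVA A) : (V → V) → Prop := C.toGradedVA.AutPlus
abbrev AutMinus (C : ConfGVA A) : (V → V) → Prop := C.toGradedVA.AutMinus
abbrev AutZero (C : ConfGVA A) : (V → V) → Prop := C.toGradedVA.AutZero

/-- `Aut_ω V`: the VOA automorphisms, i.e. the stabilizer of `ω` in `Aut V`. -/
def AutOmega (C : ConfGVA A) (f : V → V) : Prop :=
  A.IsVAAut f ∧ f C.ω = C.ω

/-- An invariant bilinear form on `(V, ω)`:
`(a(n)b, c) = (-1)^d Σ_{j≥0} (1/j!) (b, (L(1)^j a)(2d-n-2-j) c)` for `a ∈ V_d`, which is the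
coefficient form of `(Y(a,z)b, c) = (b, Y(e^{zL(1)}(-z^{-2})^{L(0)} a, z^{-1}) c)`. -/
def IsInvForm (C : ConfGVA A) (B : V →ₗ[K] V →ₗ[K] K) : Prop :=
  ∀ d : ℤ, ∀ a ∈ C.gr d, ∀ (b c : V) (n : ℤ),
    B (A.ncoef n a b) c
      = ((d.negOnePow : ℤ) : K) *
          ∑ᶠ j : ℕ, (Nat.factorial j : K)⁻¹ *
            B b (A.ncoef (2 * d - n - 2 - (j : ℤ)) ((A.ncoef 2 C.ω ^ j) a) c)

end ConfGVA

/-- A VOA of CFT type: a ℤ-graded conformal vertex algebra with `V = ⊕_{n ∈ ℕ} V_n`,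
`dim V_n < ∞`, and `V_0 = K𝟙`. -/
structure VOACFT {K V : Type*} [Field K] [AddCommGroup V] [Module K V] (A : VA K V)
    extends ConfGVA A where
  gr_neg : ∀ n : ℤ, n < 0 → gr n = ⊥
  gr_fd : ∀ n : ℤ, FiniteDimensional K (gr n)
  gr_zero : gr 0 = Submodule.span K {A.vac}

namespace VOACFT

variable {K V : Type*} [Field K] [AddCommGroup V] [Module K V] {A : VA K V}

abbrev pr (W : VOACFT A) : ℤ → V → V := W.toConfGVA.pr
abbrev ge (W : VOACFT A) : ℤ → Submodule K V := W.toConfGVA.ge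
abbrev le (W : VOACFT A) : ℤ → Submodule K V := W.toConfGVA.le
abbrev J1 (W : VOACFT A) : Set V := W.toConfGVA.J1
abbrev AutPlus (W : VOACFT A) : (V → V) → Prop := W.toConfGVA.AutPlus
abbrev AutMinus (W : VOACFT A) : (V → V) → Prop := W.toConfGVA.AutMinus
abbrev AutZero (W : VOACFT A) : (V → V) → Prop := W.toConfGVA.AutZero
abbrev AutOmega (W : VOACFT A) : (V → V) → Prop := W.toConfGVA.AutOmega
abbrev IsInvForm (W : VOACFT A) : (V →ₗ[K] V →ₗ[K] K) → Prop := W.toConfGVA.IsInvForm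

end VOACFT

/-- A VOA of strong CFT type: a VOA of CFT type with `L(1)V_1 = 0`. -/
structure VOAsCFT {K V : Type*} [Field K] [AddCommGroup V] [Module K V] (A : VA K V)
    extends VOACFT A where
  L1_V1 : ∀ v ∈ gr 1, A.ncoef 2 ω v = 0

namespace VOAsCFT

variable {K V : Type*} [Field K] [AddCommGroup V] [Module K V] {A : VA K V}

abbrev pr (W : VOAsCFT A) : ℤ → V → V := W.toVOACFT.pr
abbrev ge (W : VOAsCFT A) : ℤ → Submodule K V := W.toVOACFT.ge
abbrev le (W : VOAsCFT A) : ℤ → Submodule K V := W.toVOACFT.le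
abbrev J1 (W : VOAsCFT A) : Set V := W.toVOACFT.J1
abbrev AutPlus (W : VOAsCFT A) : (V → V) → Prop := W.toVOACFT.AutPlus
abbrev AutMinus (W : VOAsCFT A) : (V → V) → Prop := W.toVOACFT.AutMinus
abbrev AutZero (W : VOAsCFT A) : (V → V) → Prop := W.toVOACFT.AutZero
abbrev AutOmega (W : VOAsCFT A) : (V → V) → Prop := W.toVOACFT.AutOmega
abbrev IsInvForm (W : VOAsCFT A) : (V →ₗ[K] V →ₗ[K] K) → Prop := W.toVOACFT.IsInvForm

end VOAsCFT

end

section Projection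

variable {K V : Type*} [Field K] [AddCommGroup V] [Module K V]

/-- The projection onto the `n`-th summand of a `ℤ`-indexed decomposition, as an endomorphism. -/
noncomputable def decompProj (M : ℤ → Submodule K V) (D : DirectSum.Decomposition M) (n : ℤ) :
    V →ₗ[K] V :=
  letI := D
  (M n).subtype ∘ₗ DirectSum.component K ℤ (fun i => M i) n ∘ₗ
    (DirectSum.decomposeLinearEquiv M).toLinearMap

variable {M : ℤ → Submodule K V}

theorem decompProj_apply (D : DirectSum.Decomposition M) (n : ℤ) (v : V) :
    decompProj M D n v = (letI := D; (DirectSum.decompose M v n : V)) := rfl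

theorem decompProj_mem (D : DirectSum.Decomposition M) (n : ℤ) (v : V) : decompProj M D n v ∈ M n :=
  SetLike.coe_mem _

theorem decompProj_of_mem (D : DirectSum.Decomposition M)
    {n : ℤ} {v : V} (hv : v ∈ M n) : decompProj M D n v = v := by
  let := D
  exact DirectSum.decompose_of_mem_same M hv

theorem decompProj_of_mem_ne (D : DirectSum.Decomposition M)
    {n m : ℤ} {v : V} (hv : v ∈ M n) (h : n ≠ m) :
    decompProj M D m v = 0 := by
  let := D
  exact DirectSum.decompose_of_mem_ne M hv h

theorem decomp_induction (D : DirectSum.Decomposition M) {p : V → Prop} (mem : ∀ n, ∀ v ∈ M n, p v)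
    (add : ∀ u v, p u → p v → p (u + v)) (v : V) : p v := by
  let := D
  exact DirectSum.Decomposition.inductionOn M (mem 0 0 (zero_mem _))
    (fun m => mem _ m m.2) add v

theorem linearMap_ext_of_decomp (D : DirectSum.Decomposition M)
    {W : Type*} [AddCommGroup W] [Module K W] {f g : V →ₗ[K] W}
    (h : ∀ n, ∀ v ∈ M n, f v = g v) (v : V) : f v = g v :=
  decomp_induction D (p := fun v => f v = g v) h
    (fun u v hu hv => by simp only [map_add, hu, hv]) v

theorem eq_zero_of_decompProj (D : DirectSum.Decomposition M)
    {v : V} (h : ∀ n, decompProj M D n v = 0) : v = 0 := by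
  let := D
  apply (DirectSum.decompose M).injective
  rw [DirectSum.decompose_zero]
  ext n
  exact h n

theorem exists_decompProj_eq_zero_of_lt (D : DirectSum.Decomposition M)
    (v : V) : ∃ N : ℤ, ∀ n < N, decompProj M D n v = 0 := by
  refine decomp_induction D (p := fun v => ∃ N : ℤ, ∀ n < N, decompProj M D n v = 0) ?_ ?_ v
  · exact fun m v hv => ⟨m, fun n hn => decompProj_of_mem_ne D hv hn.ne'⟩
  · rintro u v ⟨N, hN⟩ ⟨N', hN'⟩
    refine ⟨min N N', fun n hn => ?_⟩
    rw [map_add, hN n (by omega), hN' n (by omega), add_zero]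

/-- A linear functional of `v` that only sees the `n`-th component of `v` may be computed there. -/
theorem linearMap_eq_of_decompProj (D : DirectSum.Decomposition M)
    {W : Type*} [AddCommGroup W] [Module K W] (f : V →ₗ[K] W)
    (n : ℤ) (v : V) (h : ∀ m, m ≠ n → f (decompProj M D m v) = 0) :
    f v = f (decompProj M D n v) := by
  classical
  let := D
  conv_lhs => rw [← DirectSum.sum_support_decompose M v, map_sum]
  rw [Finset.sum_eq_single n]
  · rfl
  · exact fun m _ hm => h m hm
  · intro hn
    rw [DFinsupp.notMem_support_iff.mp hn]
    simp

/-- The linear map acting on the `n`-th summand as the `n`-th of the given maps. -/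
noncomputable def decompGlue (M : ℤ → Submodule K V) (D : DirectSum.Decomposition M)
    (g : ℤ → V →ₗ[K] V) : V →ₗ[K] V :=
  letI := D
  DirectSum.toModule K ℤ V (fun n => g n ∘ₗ (M n).subtype) ∘ₗ
    (DirectSum.decomposeLinearEquiv M).toLinearMap

theorem decompGlue_of_mem (D : DirectSum.Decomposition M)
    (g : ℤ → V →ₗ[K] V) {n : ℤ} {v : V} (hv : v ∈ M n) :
    decompGlue M D g v = g n v := by
  let := D
  rw [decompGlue, LinearMap.comp_apply, LinearEquiv.coe_coe, DirectSum.decomposeLinearEquiv_apply,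
    DirectSum.decompose_of_mem M hv]
  exact DirectSum.toModule_lof K n _

end Projection

namespace GradedVA

variable {K V : Type*} [Field K] [AddCommGroup V] [Module K V] {A : VA K V} (G : GradedVA A)

theorem gr_le_ge {n i : ℤ} (h : n ≤ i) : G.gr i ≤ G.ge n :=
  le_iSup₂_of_le i h le_rfl

theorem ge_induction {p : V → Prop} {n : ℤ} (mem : ∀ i, n ≤ i → ∀ v ∈ G.gr i, p v)
    (add : ∀ u v, p u → p v → p (u + v)) {v : V} (hv : v ∈ G.ge n) : p v := by
  have zero : p 0 := mem n le_rfl 0 (zero_mem _)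
  refine Submodule.iSup_induction _ (motive := p) hv (fun i x hx => ?_) zero add
  exact Submodule.iSup_induction _ (motive := p) hx (fun h y hy => mem i h y hy) zero add

theorem mem_ge_iff {n : ℤ} {v : V} : v ∈ G.ge n ↔ ∀ i < n, decompProj G.gr G.decomp i v = 0 := by
  classical
  constructor
  · intro hv i hi
    refine G.ge_induction (p := fun v => decompProj G.gr G.decomp i v = 0)
      (fun j hj x hx => decompProj_of_mem_ne _ hx (by omega)) (fun u v hu hv => ?_) hv
    rw [map_add, hu, hv, add_zero]
  · intro h
    let := G.decomp
    rw [← DirectSum.sum_support_decompose G.gr v]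
    refine Submodule.sum_mem _ fun i _ => ?_
    rcases lt_or_ge i n with hi | hi
    · have := h i hi
      rw [decompProj_apply] at this
      rw [this]
      exact zero_mem _
    · exact G.gr_le_ge hi (SetLike.coe_mem _)

theorem exists_mem_ge (v : V) : ∃ N : ℤ, v ∈ G.ge N := by
  obtain ⟨N, hN⟩ := exists_decompProj_eq_zero_of_lt G.decomp v
  exact ⟨N, G.mem_ge_iff.2 hN⟩

theorem mem_ge_succ {n : ℤ} {v : V} (hv : v ∈ G.ge n) (h : decompProj G.gr G.decomp n v = 0) :
    v ∈ G.ge (n + 1) := by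
  rw [mem_ge_iff] at hv ⊢
  intro i hi
  rcases (Int.lt_add_one_iff.1 hi).lt_or_eq with hi | rfl
  · exact hv i hi
  · exact h

/-- The leading term of `a(k)b` is the `k`-th product of the leading terms. -/
theorem decompProj_ncoef {n m : ℤ} (k : ℤ) {a b : V} (ha : a ∈ G.ge n) (hb : b ∈ G.ge m) :
    decompProj G.gr G.decomp (n + m - k - 1) (A.ncoef k a b) =
      A.ncoef k (decompProj G.gr G.decomp n a) (decompProj G.gr G.decomp m b) := by
  refine G.ge_induction (p := fun a => decompProj G.gr G.decomp (n + m - k - 1) (A.ncoef k a b) =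
      A.ncoef k (decompProj G.gr G.decomp n a) (decompProj G.gr G.decomp m b))
    (fun i hi a ha => ?_) (fun u v hu hv => ?_) ha
  · refine G.ge_induction (p := fun b => decompProj G.gr G.decomp (n + m - k - 1) (A.ncoef k a b) =
      A.ncoef k (decompProj G.gr G.decomp n a) (decompProj G.gr G.decomp m b))
      (fun j hj b hb => ?_) (fun u v hu hv => ?_) hb
    · have hab := G.ncoef_mem i j k a ha b hb
      rcases hi.lt_or_eq with hi | rfl
      · rw [decompProj_of_mem_ne _ hab (by omega), decompProj_of_mem_ne _ ha hi.ne']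
        simp
      rcases hj.lt_or_eq with hj | rfl
      · rw [decompProj_of_mem_ne _ hab (by omega), decompProj_of_mem_ne _ hb hj.ne']
        simp
      rw [decompProj_of_mem _ hab, decompProj_of_mem _ ha, decompProj_of_mem _ hb]
    · simp only [map_add, hu, hv]
  · simp only [map_add, LinearMap.add_apply, hu, hv]

end GradedVA

namespace VA

variable {K V : Type*} [Field K] [AddCommGroup V] [Module K V] (A : VA K V)

theorem mem_eig {a v : V} {n : ℤ} : v ∈ A.eig a n ↔ A.ncoef 1 a v = (n : K) • v := by
  simp [eig, sub_eq_zero]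

theorem zBinom_zero (m : ℤ) : zBinom K m 0 = 1 := by simp [zBinom]

theorem zBinom_one_one : zBinom K 1 1 = 1 := by simp [zBinom]

theorem zBinom_zero_succ (i : ℕ) : zBinom K 0 (i + 1) = 0 := by
  simp [zBinom, Finset.prod_range_succ']

theorem zBinom_one_add_two (i : ℕ) : zBinom K 1 (i + 2) = 0 := by
  simp [zBinom, Finset.prod_range_succ']

/-- The commutator formula for `a(1)`. -/
theorem ncoef_one_comm (a u v : V) (k : ℤ) :
    A.ncoef 1 a (A.ncoef k u v) =
      A.ncoef (k + 1) (A.ncoef 0 a u) v + A.ncoef k (A.ncoef 1 a u) v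
        + A.ncoef k u (A.ncoef 1 a v) := by
  have h := A.borcherds a u v 0 k 1
  rw [finsum_eq_sum_of_support_subset (s := Finset.range 2),
    finsum_eq_sum_of_support_subset (s := Finset.range 1)] at h
  · simp only [Finset.sum_range_succ, Finset.sum_range_zero, zBinom_zero, zBinom_one_one] at h
    simp only [Nat.cast_zero, Nat.cast_one, sub_zero, add_zero, zero_add, one_smul, pow_zero,
      one_mul, Int.negOnePow_zero, Units.val_one, Int.cast_one, add_sub_cancel_left] at h
    rw [add_comm k 1, h]
    abel
  · intro i hi
    rcases i with _ | i
    · simp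
    · simp [zBinom_zero_succ] at hi
  · intro i hi
    rcases i with _ | _ | i
    · simp
    · simp
    · simp [zBinom_one_add_two] at hi

end VA

namespace VA

variable {K V : Type*} [Field K] [AddCommGroup V] [Module K V] {A : VA K V}

/-- The linear equivalence underlying a vertex algebra automorphism. -/
noncomputable def IsVAAut.toLinearEquiv {f : V → V} (hf : A.IsVAAut f) : V ≃ₗ[K] V :=
  LinearEquiv.ofBijective
    { toFun := f, map_add' := hf.1.map_add, map_smul' := hf.1.map_smul } hf.2

theorem IsVAAut.toLinearEquiv_apply {f : V → V} (hf : A.IsVAAut f) (v : V) :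
    hf.toLinearEquiv v = f v := rfl

theorem IsVAAut.map_eig {f : V → V} (hf : A.IsVAAut f) (a : V) (n : ℤ) :
    A.eig (f a) n = (A.eig a n).map hf.toLinearEquiv.toLinearMap := by
  ext v
  obtain ⟨u, rfl⟩ := hf.toLinearEquiv.surjective v
  rw [hf.toLinearEquiv_apply]
  constructor
  · intro h
    refine ⟨u, A.mem_eig.2 (hf.2.injective ?_), rfl⟩
    rw [hf.1.map_ncoef, hf.1.map_smul]
    exact A.mem_eig.1 h
  · rintro ⟨w, hw, h⟩
    have h : f w = f u := h
    rw [← h, VA.mem_eig, ← hf.1.map_ncoef, A.mem_eig.1 hw, hf.1.map_smul]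

theorem IsVAAut.map_isConformal {f : V → V} (hf : A.IsVAAut f) {a : V} (ha : A.IsConformal a) :
    A.IsConformal (f a) := by
  obtain ⟨h1, ⟨c, h3⟩, h2, h4, h0, hsum⟩ := ha
  have f_zero : f 0 = 0 := hf.toLinearEquiv.map_zero
  refine ⟨?_, ⟨c, ?_⟩, ?_, fun n hn => ?_, ?_, ?_⟩
  · rw [← hf.1.map_ncoef, h1, hf.1.map_smul]
  · rw [← hf.1.map_ncoef, h3, hf.1.map_smul, hf.1.map_vac]
  · rw [← hf.1.map_ncoef, h2, f_zero]
  · rw [← hf.1.map_ncoef, h4 n hn, f_zero]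
  · ext v
    obtain ⟨u, rfl⟩ := hf.2.surjective v
    rw [← hf.1.map_ncoef, h0]
    change f (A.ncoef (-2) u A.vac) = A.ncoef (-2) (f u) A.vac
    rw [hf.1.map_ncoef, hf.1.map_vac]
  · rw [DirectSum.isInternal_submodule_iff_iSupIndep_and_iSup_eq_top] at hsum ⊢
    rw [funext (hf.map_eig a)]
    refine ⟨hsum.1.map_orderIso (Submodule.orderIsoMapComap hf.toLinearEquiv), ?_⟩
    rw [← Submodule.map_iSup, hsum.2, Submodule.map_top, LinearEquiv.range]

theorem IsVAAut.map_mem_eig {f : V → V} (hf : A.IsVAAut f) {a v : V} {n : ℤ}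
    (hv : v ∈ A.eig a n) : f v ∈ A.eig (f a) n := by
  rw [hf.map_eig]
  exact Submodule.mem_map_of_mem hv

end VA

namespace ConfGVA

variable {K V : Type*} [Field K] [AddCommGroup V] [Module K V] {A : VA K V} (C : ConfGVA A)

theorem ncoef_T (C : ConfGVA A) (u v : V) (k : ℤ) :
    A.ncoef (k + 1) (A.T u) v = -((k : K) + 1) • A.ncoef k u v := by
  refine decomp_induction C.decomp
    (p := fun u => A.ncoef (k + 1) (A.T u) v = -((k : K) + 1) • A.ncoef k u v)
    (fun n u hu => ?_)
    (fun a b ha hb => by simp only [map_add, LinearMap.add_apply, ha, hb, smul_add]) u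
  refine decomp_induction C.decomp
    (p := fun v => A.ncoef (k + 1) (A.T u) v = -((k : K) + 1) • A.ncoef k u v)
    (fun m v hv => ?_) (fun a b ha hb => by simp only [map_add, ha, hb, smul_add]) v
  have h := A.ncoef_one_comm C.ω u v k
  rw [C.L0_grading _ _ (C.ncoef_mem n m k u hu v hv), C.L0_grading _ _ hu, C.L0_grading _ _ hv,
    C.Lneg1_eq_T] at h
  simp only [map_smul, LinearMap.smul_apply] at h
  rw [add_assoc, ← sub_eq_iff_eq_add] at h
  rw [← h]
  push_cast
  module

theorem ncoef_mem_eig (C : ConfGVA A) {a u v : V} (ha : A.ncoef 0 a = A.T) {n m : ℤ} (k : ℤ)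
    (hu : u ∈ A.eig a n) (hv : v ∈ A.eig a m) : A.ncoef k u v ∈ A.eig a (n + m - k - 1) := by
  rw [VA.mem_eig] at *
  rw [A.ncoef_one_comm, ha, C.ncoef_T, hu, hv]
  simp only [map_smul, LinearMap.smul_apply]
  push_cast
  module

theorem L0_decompProj (n : ℤ) (v : V) :
    decompProj C.gr C.decomp n (A.ncoef 1 C.ω v) = (n : K) • decompProj C.gr C.decomp n v := by
  refine linearMap_ext_of_decomp C.decomp (f := decompProj C.gr C.decomp n ∘ₗ A.ncoef 1 C.ω)
    (g := (n : K) • decompProj C.gr C.decomp n) (fun m v hv => ?_) v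
  simp only [LinearMap.comp_apply, LinearMap.smul_apply]
  rw [C.L0_grading m v hv, map_smul]
  by_cases h : m = n
  · rw [h]
  · rw [decompProj_of_mem_ne _ hv h, smul_zero, smul_zero]

theorem eig_ω [CharZero K] (n : ℤ) : A.eig C.ω n = C.gr n := by
  refine le_antisymm (fun v hv => ?_) (fun v hv => A.mem_eig.2 (C.L0_grading n v hv))
  rw [VA.mem_eig] at hv
  suffices h : v - decompProj C.gr C.decomp n v = 0 by
    rw [sub_eq_zero.1 h]
    exact decompProj_mem _ _ _
  refine eq_zero_of_decompProj C.decomp fun m => ?_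
  by_cases hm : n = m
  · subst hm
    rw [map_sub, decompProj_of_mem _ (decompProj_mem _ _ _), sub_self]
  · have h := C.L0_decompProj m v
    rw [hv, map_smul, ← sub_eq_zero, ← sub_smul, smul_eq_zero, sub_eq_zero, Int.cast_inj] at h
    rw [map_sub, decompProj_of_mem_ne _ (decompProj_mem _ _ _) hm, h.resolve_left hm, sub_zero]

theorem isConformal_ω [CharZero K] : A.IsConformal C.ω := by
  obtain ⟨c, hc⟩ := C.virasoro
  have key : ∀ n : ℤ, -1 ≤ n → A.ncoef (n + 1) C.ω C.ω =
      ((n : K) + 2) • A.ncoef (n - 1) C.ω A.vac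
        + (if n = 2 then ((n : K) ^ 3 - (n : K)) / 12 * c else 0) • A.vac := by
    intro n hn
    have h := LinearMap.congr_fun (hc n (-2)) A.vac
    simp only [LinearMap.sub_apply, LinearMap.comp_apply, LinearMap.add_apply,
      LinearMap.smul_apply, LinearMap.id_apply] at h
    rw [A.ncoef_vac_zero (n + 1) (by omega), map_zero, sub_zero,
      show (-2 + 1 : ℤ) = -1 by norm_num, A.ncoef_vac] at h
    rw [h]
    have e : (n + -2 = 0) ↔ (n = 2) := by omega
    simp only [e]
    rw [show n + -2 + 1 = n - 1 by ring]
    push_cast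
    rw [sub_neg_eq_add]
  refine ⟨?_, ?_, ?_, ?_, C.Lneg1_eq_T, ?_⟩
  · simpa using C.L0_grading 2 _ C.ω_mem
  · have h := key 2 (by norm_num)
    rw [A.ncoef_vac_zero _ (by norm_num), smul_zero, zero_add, if_pos rfl] at h
    exact ⟨_, h⟩
  · have h := key 1 (by norm_num)
    rwa [A.ncoef_vac_zero _ (by norm_num), smul_zero, zero_add, if_neg (by norm_num),
      zero_smul] at h
  · intro n hn
    have h := key (n - 1) (by omega)
    rwa [A.ncoef_vac_zero _ (by omega), smul_zero, zero_add, if_neg (by omega),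
      zero_smul, sub_add_cancel] at h
  · rw [funext C.eig_ω]
    exact C.decomp.isInternal

theorem decompProj_ncoef_one {a : V} (ha : a ∈ C.ge 2) (hω : C.pr 2 a = C.ω) {n : ℤ} {v : V}
    (hv : v ∈ C.ge n) :
    decompProj C.gr C.decomp n (A.ncoef 1 a v) = (n : K) • decompProj C.gr C.decomp n v := by
  have h := C.decompProj_ncoef 1 ha hv
  have hω' : decompProj C.gr C.decomp 2 a = C.ω := hω
  rw [hω', show 2 + n - 1 - 1 = n by ring, C.L0_grading n _ (decompProj_mem _ _ _)] at h
  exact h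

theorem mem_ge_succ_of_mem_eig [CharZero K] {a : V} (ha : a ∈ C.ge 2) (hω : C.pr 2 a = C.ω)
    {n m : ℤ} {v : V} (hv : v ∈ A.eig a n) (hm : v ∈ C.ge m) (h : m ≠ n) : v ∈ C.ge (m + 1) := by
  refine C.mem_ge_succ hm ?_
  have e := C.decompProj_ncoef_one ha hω hm
  rw [A.mem_eig.1 hv, map_smul, ← sub_eq_zero, ← sub_smul, smul_eq_zero, sub_eq_zero,
    Int.cast_inj] at e
  exact e.resolve_left h.symm

/-- The component of least degree of a vector in `V_n^a` has degree `n`. -/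
theorem eig_le_ge [CharZero K] {a : V} (ha : a ∈ C.ge 2) (hω : C.pr 2 a = C.ω) (n : ℤ) :
    A.eig a n ≤ C.ge n := by
  intro v hv
  obtain ⟨N, hN⟩ := C.exists_mem_ge v
  have key : ∀ m, min N n ≤ m → m ≤ n → v ∈ C.ge m := by
    intro m hm
    induction m, hm using Int.leInduction with
    | base =>
      intro _
      rw [C.mem_ge_iff] at hN ⊢
      exact fun i hi => hN i (by omega)
    | succ m _ ih =>
      exact fun h => C.mem_ge_succ_of_mem_eig ha hω hv (ih (by omega)) (by omega)
  exact key n (min_le_right _ _) le_rfl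

theorem eq_zero_of_mem_eig [CharZero K] {a : V} (ha : a ∈ C.ge 2) (hω : C.pr 2 a = C.ω)
    {n : ℤ} {v : V} (hv : v ∈ A.eig a n) (h : decompProj C.gr C.decomp n v = 0) : v = 0 := by
  have key : ∀ m, n + 1 ≤ m → v ∈ C.ge m := by
    intro m hm
    induction m, hm using Int.leInduction with
    | base => exact C.mem_ge_succ (C.eig_le_ge ha hω n hv) h
    | succ m _ ih => exact C.mem_ge_succ_of_mem_eig ha hω hv ih (by omega)
  exact eq_zero_of_decompProj C.decomp fun i =>
    C.mem_ge_iff.1 (key (max (n + 1) (i + 1)) (le_max_left _ _)) i (by omega)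

theorem eq_of_mem_eig [CharZero K] {a : V} (ha : a ∈ C.ge 2) (hω : C.pr 2 a = C.ω)
    {n : ℤ} {u v : V} (hu : u ∈ A.eig a n) (hv : v ∈ A.eig a n)
    (h : decompProj C.gr C.decomp n u = decompProj C.gr C.decomp n v) : u = v :=
  sub_eq_zero.1 <| C.eq_zero_of_mem_eig ha hω (sub_mem hu hv) (by rw [map_sub, h, sub_self])

/-- The components in `V_m^a`, `m < n`, of a vector in `V_{≥n}` vanish. -/
theorem decompProj_eig_eq_zero [CharZero K] {a : V} (ha : a ∈ C.ge 2) (hω : C.pr 2 a = C.ω)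
    (D : DirectSum.Decomposition (A.eig a)) {n : ℤ} {v : V} (hv : v ∈ C.ge n) (m : ℤ)
    (hm : m < n) : decompProj (A.eig a) D m v = 0 := by
  obtain ⟨N, hN⟩ := exists_decompProj_eq_zero_of_lt D v
  have key : ∀ k, N ≤ k → k ≤ n → ∀ m < k, decompProj (A.eig a) D m v = 0 := by
    intro k hk
    induction k, hk using Int.leInduction with
    | base => exact fun _ => hN
    | succ k _ ih =>
      intro hkn m hm
      rcases (Int.lt_add_one_iff.1 hm).lt_or_eq with hm | rfl
      · exact ih (by omega) m hm
      refine C.eq_zero_of_mem_eig ha hω (decompProj_mem _ _ _) ?_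
      rw [← linearMap_eq_of_decompProj D (decompProj C.gr C.decomp m) m v,
        C.mem_ge_iff.1 hv m (by omega)]
      intro j hj
      rcases hj.lt_or_gt with hj | hj
      · rw [ih (by omega) j hj, map_zero]
      · exact C.mem_ge_iff.1 (C.eig_le_ge ha hω j (decompProj_mem _ _ _)) m hj
  rcases le_or_gt N n with h | h
  · exact key n h le_rfl m hm
  · exact hN m (hm.trans h)

theorem decompProj_decompProj_eig [CharZero K] {a : V} (ha : a ∈ C.ge 2) (hω : C.pr 2 a = C.ω)
    (D : DirectSum.Decomposition (A.eig a)) {n : ℤ} {v : V} (hv : v ∈ C.gr n) :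
    decompProj C.gr C.decomp n (decompProj (A.eig a) D n v) = v := by
  rw [← linearMap_eq_of_decompProj D (decompProj C.gr C.decomp n) n v,
    decompProj_of_mem _ hv]
  intro j hj
  rcases hj.lt_or_gt with hj | hj
  · rw [C.decompProj_eig_eq_zero ha hω D (C.gr_le_ge le_rfl hv) j hj, map_zero]
  · exact C.mem_ge_iff.1 (C.eig_le_ge ha hω j (decompProj_mem _ _ _)) n hj

theorem exists_autPlus [CharZero K] {a : V} (hconf : A.IsConformal a) (ha : a ∈ C.ge 2)
    (hω : C.pr 2 a = C.ω) : ∃ f, C.AutPlus f ∧ f C.ω = a := by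
  obtain ⟨h1, -, -, -, h0, hsum⟩ := hconf
  let D := hsum.chooseDecomposition
  let f := decompGlue C.gr C.decomp (decompProj (A.eig a) D)
  let g := decompGlue (A.eig a) D (decompProj C.gr C.decomp)
  have hf : ∀ {n v}, v ∈ C.gr n → f v = decompProj (A.eig a) D n v :=
    fun hv => decompGlue_of_mem C.decomp _ hv
  have hg : ∀ {n v}, v ∈ A.eig a n → g v = decompProj C.gr C.decomp n v :=
    fun hv => decompGlue_of_mem D _ hv
  have f_mem : ∀ {n v}, v ∈ C.gr n → f v ∈ A.eig a n := fun hv => by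
    rw [hf hv]
    exact decompProj_mem _ _ _
  have pr_f : ∀ {n v}, v ∈ C.gr n → decompProj C.gr C.decomp n (f v) = v := fun hv => by
    rw [hf hv]
    exact C.decompProj_decompProj_eig ha hω D hv
  have gf : ∀ v, g (f v) = v := fun v =>
    linearMap_ext_of_decomp C.decomp (f := g ∘ₗ f) (g := LinearMap.id)
      (fun n v hv => (hg (f_mem hv)).trans (pr_f hv)) v
  have fg : ∀ v, f (g v) = v := fun v =>
    linearMap_ext_of_decomp D (f := f ∘ₗ g) (g := LinearMap.id) (fun n v hv => by
      simp only [LinearMap.comp_apply, LinearMap.id_apply, hg hv]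
      exact C.eq_of_mem_eig ha hω (f_mem (decompProj_mem _ _ _)) hv (pr_f (decompProj_mem _ _ _))) v
  have hprod : ∀ (k : ℤ) (u v : V), f (A.ncoef k u v) = A.ncoef k (f u) (f v) := by
    intro k u v
    refine decomp_induction C.decomp (p := fun u => f (A.ncoef k u v) = A.ncoef k (f u) (f v))
      (fun n u hu => ?_)
      (fun x y hx hy => by simp only [map_add, LinearMap.add_apply, hx, hy]) u
    refine decomp_induction C.decomp (p := fun v => f (A.ncoef k u v) = A.ncoef k (f u) (f v))
      (fun m v hv => ?_) (fun x y hx hy => by simp only [map_add, hx, hy]) v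
    refine C.eq_of_mem_eig ha hω (f_mem (C.ncoef_mem n m k u hu v hv))
      (C.ncoef_mem_eig h0 k (f_mem hu) (f_mem hv)) ?_
    rw [pr_f (C.ncoef_mem n m k u hu v hv), C.decompProj_ncoef k
      (C.eig_le_ge ha hω n (f_mem hu)) (C.eig_le_ge ha hω m (f_mem hv)), pr_f hu, pr_f hv]
  have hvac : f A.vac = A.vac := by
    refine C.eq_of_mem_eig ha hω (f_mem C.vac_mem) ?_ ?_
    · rw [VA.mem_eig, A.ncoef_vac_zero 1 (by norm_num)]
      simp
    · rw [pr_f C.vac_mem, decompProj_of_mem _ C.vac_mem]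
  refine ⟨f, ⟨⟨⟨f.map_add, f.map_smul, hprod, hvac⟩,
    Function.bijective_iff_has_inverse.2 ⟨g, gf, fg⟩⟩, fun n v hv =>
      ⟨C.eig_le_ge ha hω n (f_mem hv), pr_f hv⟩⟩, ?_⟩
  refine C.eq_of_mem_eig ha hω (f_mem C.ω_mem) (A.mem_eig.2 (by simpa using h1)) ?_
  rw [pr_f C.ω_mem]
  exact hω.symm

end ConfGVA

/-- Corollary `Aut_p`: the map `φ : Aut⁺V → CV⁺`, `f ↦ f(ω)`, is a
bijection, where `CV⁺ = {a ∈ CV ∩ V_{≥2} | pr_2(a) = ω}`. -/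
theorem autPlus_bijOn_CVplus {K V : Type*} [RCLike K] [AddCommGroup V] [Module K V]
    (A : VA K V) (C : ConfGVA A) :
    Set.BijOn (fun f : V → V => f C.ω)
      {f : V → V | C.AutPlus f}
      {a : V | A.IsConformal a ∧ a ∈ C.ge 2 ∧ C.pr 2 a = C.ω} := by
  refine ⟨?_, ?_, ?_⟩
  · intro f hf
    exact ⟨hf.1.map_isConformal C.isConformal_ω, hf.2 2 C.ω C.ω_mem⟩
  · intro f hf g hg (h : f C.ω = g C.ω)
    funext v
    refine linearMap_ext_of_decomp C.decomp (f := hf.1.toLinearEquiv.toLinearMap)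
      (g := hg.1.toLinearEquiv.toLinearMap) (fun n v hv => ?_) v
    obtain ⟨ha, hω⟩ := hf.2 2 C.ω C.ω_mem
    have hv' : v ∈ A.eig C.ω n := A.mem_eig.2 (C.L0_grading n v hv)
    refine C.eq_of_mem_eig ha hω (hf.1.map_mem_eig hv') ?_
      ((hf.2 n v hv).2.trans (hg.2 n v hv).2.symm)
    rw [h]
    exact hg.1.map_mem_eig hv'
  · rintro a ⟨hconf, ha, hω⟩
    exact C.exists_autPlus hconf ha hω
end

section
/- Let (V, ω) be a VOA of CFT type and let a ∈ V_n with n ≥ 2. If a(0)ω = 0, then a ∈ Im T. -/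
theorem zBinom_zero_right (K : Type*) [Field K] (m : ℤ) : zBinom K m 0 = 1 := by
  simp [zBinom]

theorem zBinom_succ (K : Type*) [Field K] (m : ℤ) (i : ℕ) :
    zBinom K m (i + 1) = zBinom K m i * (((m : K) - i) / ((i : K) + 1)) := by
  simp only [zBinom, Finset.prod_range_succ, Nat.factorial_succ, Nat.cast_mul, Nat.cast_succ]
  rw [mul_comm ((i : K) + 1), mul_div_mul_comm]

theorem zBinom_zero_left (K : Type*) [Field K] {i : ℕ} (hi : i ≠ 0) : zBinom K 0 i = 0 := by
  obtain ⟨i, rfl⟩ := Nat.exists_eq_succ_of_ne_zero hi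
  simp [zBinom, Finset.prod_range_succ']

theorem zBinom_neg_one (K : Type*) [Field K] [CharZero K] (i : ℕ) :
    zBinom K (-1) i = (-1) ^ i := by
  induction i with
  | zero => simp [zBinom_zero_right]
  | succ i ih =>
    have : (i : K) + 1 ≠ 0 := Nat.cast_add_one_ne_zero i
    rw [zBinom_succ, ih]
    push_cast
    field_simp
    ring

theorem zBinom_neg_two (K : Type*) [Field K] [CharZero K] (i : ℕ) :
    zBinom K (-2) i = (-1) ^ i * ((i : K) + 1) := by
  induction i with
  | zero => simp [zBinom_zero_right]
  | succ i ih =>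
    have : (i : K) + 1 ≠ 0 := Nat.cast_add_one_ne_zero i
    rw [zBinom_succ, ih]
    push_cast
    field_simp
    ring

namespace VA

variable {K V : Type*} [Field K] [AddCommGroup V] [Module K V]

theorem T_apply (A : VA K V) (a : V) : A.T a = A.ncoef (-2) a A.vac := rfl

/-- The commutator formula for the zeroth mode: `a(0)` is a derivation of all products. -/
theorem ncoef_zero_ncoef (A : VA K V) (a b c : V) (q : ℤ) :
    A.ncoef q (A.ncoef 0 a b) c
      = A.ncoef 0 a (A.ncoef q b c) - A.ncoef q b (A.ncoef 0 a c) := by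
  have h := A.borcherds a b c 0 q 0
  rw [finsum_eq_single _ 0 fun i hi => by simp [zBinom_zero_left K hi],
    finsum_eq_single _ 0 fun i hi => by simp [zBinom_zero_left K hi]] at h
  simpa [zBinom_zero_right] using h

/-- Skew-symmetry, with `x(-1-i)𝟙` in place of `T^i x / i!`. -/
theorem skew_symmetry [CharZero K] (A : VA K V) (a b : V) (p : ℤ) :
    ∑ᶠ i : ℕ, (-1 : K) ^ i • A.ncoef (-1 - (i : ℤ)) (A.ncoef (p + i) a b) A.vac
      = -((p.negOnePow : ℤ) : K) • A.ncoef p b a := by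
  have h := A.borcherds a b A.vac p 0 (-1)
  simp only [zBinom_neg_one, add_zero] at h
  rw [h, finsum_eq_single _ 0]
  · simp [zBinom_zero_right, A.ncoef_vac_zero, A.ncoef_vac]
  · intro i hi
    rw [A.ncoef_vac_zero (0 + (i : ℤ)) (by omega), A.ncoef_vac_zero (-1 + (i : ℤ)) (by omega)]
    simp

theorem ncoef_T_of_neg [CharZero K] (A : VA K V) (a c : V) {k : ℤ} (hk : k < 0) :
    A.ncoef k (A.T a) c = (-k : K) • A.ncoef (k - 1) a c := by
  have h := A.borcherds a A.vac c (-2) k 0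
  rw [finsum_eq_single _ 0 fun i hi => by simp [zBinom_zero_left K hi],
    finsum_eq_single _ (-1 - k).toNat] at h
  · have hi : (((-1 - k).toNat : ℕ) : ℤ) = -1 - k := Int.toNat_of_nonneg (by omega)
    have hi' : (((-1 - k).toNat : ℕ) : K) = -1 - k := by exact_mod_cast congrArg (Int.cast : ℤ → K) hi
    rw [zBinom_neg_two, hi, hi', A.vac_ncoef, A.vac_ncoef, if_pos (by ring),
      if_neg (by omega), ← mul_assoc, ← mul_pow] at h
    simp only [zBinom_zero_right] at h
    simp only [Nat.cast_zero, add_zero, zero_add, sub_zero, one_smul, smul_zero, mul_neg, neg_neg,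
      mul_one, one_pow, one_mul] at h
    rw [T_apply, h]
    congr 2
    · ring
    · ring_nf
  · intro i hi
    rw [A.vac_ncoef, A.vac_ncoef, if_neg (by omega), if_neg (by omega)]
    simp

theorem ncoef_T_of_pos [CharZero K] (A : VA K V) (a c : V) {k : ℤ} (hk : 0 < k) :
    A.ncoef k (A.T a) c = (-k : K) • A.ncoef (k - 1) a c := by
  have h := A.borcherds a A.vac c (-2) k 0
  rw [finsum_eq_single _ 0 fun i hi => by simp [zBinom_zero_left K hi],
    finsum_eq_single _ (k - 1).toNat] at h
  · have hi : (((k - 1).toNat : ℕ) : ℤ) = k - 1 := Int.toNat_of_nonneg (by omega)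
    have hi' : (((k - 1).toNat : ℕ) : K) = k - 1 := by exact_mod_cast congrArg (Int.cast : ℤ → K) hi
    rw [zBinom_neg_two, hi, hi', A.vac_ncoef, A.vac_ncoef, if_neg (by omega),
      if_pos (by ring), ← mul_assoc, ← mul_pow, Int.negOnePow_even (-2) (by decide)] at h
    simp only [zBinom_zero_right] at h
    simp only [Nat.cast_zero, add_zero, zero_add, sub_zero, one_smul, map_zero, mul_neg, neg_neg,
      mul_one, one_pow, one_mul, Units.val_one, Int.cast_one, zero_sub, smul_neg,
      sub_add_cancel] at h
    rw [T_apply, h, neg_smul]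
  · intro i hi
    rw [A.vac_ncoef, A.vac_ncoef, if_neg (by omega), if_neg (by omega)]
    simp

end VA

namespace ConfGVA

variable {K V : Type*} [Field K] [AddCommGroup V] [Module K V] {A : VA K V}

theorem T_ncoef_vac [CharZero K] (C : ConfGVA A) (x : V) {k : ℤ} (hk : k < 0) :
    A.T (A.ncoef k x A.vac) = (-k : K) • A.ncoef (k - 1) x A.vac := by
  have h := A.ncoef_zero_ncoef C.ω x A.vac k
  rw [A.ncoef_vac_zero 0 le_rfl, map_zero, sub_zero, C.Lneg1_eq_T] at h
  rw [← h, A.ncoef_T_of_neg x A.vac hk]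

/-- Translation is injective on homogeneous vectors of nonzero weight. -/
theorem eq_zero_of_T_eq_zero [CharZero K] (C : ConfGVA A) {n : ℤ} (hn : n ≠ 0) {u : V}
    (hu : u ∈ C.gr n) (hT : A.T u = 0) : u = 0 := by
  have hmodes (k : ℤ) (hk : 0 < k) : A.ncoef (k - 1) u C.ω = 0 := by
    have h := A.ncoef_T_of_pos u C.ω hk
    rw [hT, map_zero, LinearMap.zero_apply] at h
    exact (smul_eq_zero.mp h.symm).resolve_left (by simpa using hk.ne')
  have h := A.skew_symmetry u C.ω 1
  rw [finsum_eq_zero_of_forall_eq_zero fun i => by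
    have := hmodes (1 + i + 1) (by omega)
    rw [add_sub_cancel_right] at this
    simp [this]] at h
  simp only [Int.negOnePow_one, C.L0_grading n u hu] at h
  simpa [hn] using h.symm

end ConfGVA

/-- Lemma `zero`: in a VOA of CFT type, if `a ∈ V_n` with `n ≥ 2`
and `a(0)ω = 0`, then `a ∈ Im T`. -/
theorem mem_range_T_of_ncoef_zero_omega {K V : Type*} [RCLike K]
    [AddCommGroup V] [Module K V]
    (A : VA K V) (W : VOACFT A) (n : ℤ) (hn : 2 ≤ n) (a : V)
    (ha : a ∈ W.gr n) (h : A.ncoef 0 a W.ω = 0) :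
    a ∈ LinearMap.range A.T := by
  obtain ⟨N₀, hN₀⟩ := A.trunc W.ω a
  obtain ⟨N, hN⟩ : ∃ N : ℕ, ∀ k : ℤ, N ≤ k → A.ncoef k W.ω a = 0 :=
    ⟨N₀.toNat, fun k hk => hN₀ k (by omega)⟩
  have hskew := A.skew_symmetry W.ω a 0
  rw [h, smul_zero, finsum_eq_sum_of_support_subset (s := Finset.range (N + 2))] at hskew
  swap
  · intro i hi
    contrapose! hi
    simp [hN i (by simp at hi; omega)]
  simp only [zero_add] at hskew
  rw [Finset.sum_range_succ', Finset.sum_range_succ'] at hskew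
  set y : V := ∑ i ∈ Finset.range N, ((-1 : K) ^ i * ((i : K) + 2)⁻¹ * ((i : K) + 1)⁻¹) •
    A.ncoef (-1 - (i : ℤ)) (A.ncoef (i + 2) W.ω a) A.vac with hy
  have hTT (i : ℕ) (x : V) : A.T (A.T (A.ncoef (-1 - (i : ℤ)) x A.vac))
      = (((i : K) + 1) * ((i : K) + 2)) • A.ncoef (-1 - ((i + 1 + 1 : ℕ) : ℤ)) x A.vac := by
    rw [W.T_ncoef_vac x (by omega), map_smul, W.T_ncoef_vac x (by omega), smul_smul,
      show -1 - (i : ℤ) - 1 - 1 = -1 - ((i + 1 + 1 : ℕ) : ℤ) by push_cast; ring]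
    congr 1
    push_cast
    ring
  have hTTy : A.T (A.T y) = ∑ i ∈ Finset.range N, (-1 : K) ^ (i + 1 + 1) •
      A.ncoef (-1 - ((i + 1 + 1 : ℕ) : ℤ)) (A.ncoef ((i + 1 + 1 : ℕ) : ℤ) W.ω a) A.vac := by
    rw [hy, map_sum, map_sum]
    refine Finset.sum_congr rfl fun i _ => ?_
    have h1 : (i : K) + 1 ≠ 0 := Nat.cast_add_one_ne_zero i
    have h2 : (i : K) + 2 ≠ 0 := by exact_mod_cast (by omega : i + 2 ≠ 0)
    have h3 : (((i + 1 + 1 : ℕ) : ℤ)) = i + 2 := by push_cast; ring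
    rw [map_smul, map_smul, hTT, smul_smul, h3]
    congr 1
    field_simp
    ring
  have hyn : A.T y ∈ W.gr n := by
    rw [hy, map_sum]
    refine Submodule.sum_mem _ fun i _ => ?_
    rw [map_smul]
    refine Submodule.smul_mem _ _ ?_
    have hx := W.ncoef_mem 2 n (i + 2) W.ω W.ω_mem a ha
    have hx' := W.ncoef_mem _ _ (-1 - (i : ℤ)) _ hx _ W.vac_mem
    have hx'' := W.ncoef_mem _ _ (-2) _ hx' _ W.vac_mem
    rw [VA.T_apply]
    convert hx'' using 2
    ring
  have hu : A.T y + ((1 - n : ℤ) : K) • a = 0 := by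
    refine W.eq_zero_of_T_eq_zero (n := n) (by omega)
      (Submodule.add_mem _ hyn (Submodule.smul_mem _ _ ha)) ?_
    rw [← hTTy] at hskew
    rw [map_add, map_smul]
    simp only [zero_add, Nat.cast_one, Nat.cast_zero, pow_one, pow_zero, one_smul, sub_zero,
      W.L0_grading n a ha, W.Lneg1_eq_T, A.ncoef_vac] at hskew
    rw [map_smul, LinearMap.smul_apply, show (-1 - 1 : ℤ) = -2 by norm_num,
      ← VA.T_apply] at hskew
    rw [← hskew]
    push_cast
    module
  have hn1 : ((n - 1 : ℤ) : K) ≠ 0 := Int.cast_ne_zero.mpr (by omega)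
  refine ⟨((n - 1 : ℤ) : K)⁻¹ • y, ?_⟩
  rw [map_smul, eq_neg_of_add_eq_zero_left hu, ← neg_smul, smul_smul]
  convert one_smul K a
  push_cast at hn1 ⊢
  field_simp
  ring
end
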